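/- arXiv:1504.08307 — 7 statements merged into one kernel-verified Lean document; each statement's English description precedes it below -/
import Mathlib

section
/- Let k be a field and V a finite-dimensional k-vector space with a direct sum decomposition V = V⁺ ⊕ V⁻. Let D be a k-linear endomorphism of V that is odd, i.e. D(V⁺) ⊆ V⁻ and D(V⁻) ⊆ V⁺, and assume D² is diagonalizable, i.e. V is the (internal direct) sum of the eigenspaces of D². Then ker D and range D are graded subspaces (each is the direct sum of its intersections with V⁺ and V⁻), and dim V⁺ − dim V⁻ = [dim(ker D ∩ V⁺) − dim(ker D ∩ range D ∩ V⁺)] − [dim(ker D ∩ V⁻) − dim(ker D ∩ range D ∩ V⁻)]. -/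
lemma aux_rank {k V : Type*} [Field k] [AddCommGroup V] [Module k V] [FiniteDimensional k V]
    (D : V →ₗ[k] V) (W : Submodule k V) :
    Module.finrank k ↥(LinearMap.ker D ⊓ W) + Module.finrank k ↥(W.map D) =
      Module.finrank k W := by
  have h := LinearMap.finrank_range_add_finrank_ker (D.domRestrict W)
  have h1 : LinearMap.range (D.domRestrict W) = W.map D := by
    ext y; simp [LinearMap.domRestrict_apply]
  have h2 : (LinearMap.ker (D.domRestrict W)).map W.subtype = LinearMap.ker D ⊓ W := by
    ext y; simp [LinearMap.domRestrict_apply, and_comm]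
  have h3 := (Submodule.equivMapOfInjective W.subtype W.subtype_injective
    (LinearMap.ker (D.domRestrict W))).finrank_eq
  rw [h2] at h3
  rw [h1] at h
  omega

lemma aux_sq {k V : Type*} [Field k] [AddCommGroup V] [Module k V]
    (D : V →ₗ[k] V)
    (hdiag : (⨆ μ : k, Module.End.eigenspace (D ∘ₗ D) μ) = ⊤) (x : V) :
    ∃ y, D (D x) = D (D (D (D y))) := by
  have hx : x ∈ (⨆ μ : k, Module.End.eigenspace (D ∘ₗ D) μ) := hdiag ▸ Submodule.mem_top
  induction hx using Submodule.iSup_induction' with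
  | mem μ x hx =>
    have h : D (D x) = μ • x := by simpa using Module.End.mem_eigenspace_iff.1 hx
    by_cases hμ : μ = 0
    · exact ⟨0, by simp [h, hμ]⟩
    · exact ⟨μ⁻¹ • x, by simp [h, hμ]⟩
  | zero => exact ⟨0, by simp⟩
  | add x y _ _ hx hy =>
    obtain ⟨a, ha⟩ := hx
    obtain ⟨b, hb⟩ := hy
    exact ⟨a + b, by simp [ha, hb]⟩

lemma aux_le {k V : Type*} [Field k] [AddCommGroup V] [Module k V] [FiniteDimensional k V]
    (Vp Vm : Submodule k V) (hcompl : IsCompl Vp Vm)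
    (D : V →ₗ[k] V)
    (hodd₁ : ∀ x ∈ Vp, D x ∈ Vm) (hodd₂ : ∀ x ∈ Vm, D x ∈ Vp)
    (hdiag : (⨆ μ : k, Module.End.eigenspace (D ∘ₗ D) μ) = ⊤) :
    Module.finrank k ↥((Vp.map D).map D) ≤ Module.finrank k ↥((Vm.map D).map D) := by
  have h : (Vp.map D).map D ≤ ((Vm.map D).map D).map D := by
    rintro _ ⟨_, ⟨x, hx, rfl⟩, rfl⟩
    obtain ⟨y, hy⟩ := aux_sq D hdiag x
    obtain ⟨a, ha, b, hb, rfl⟩ := Submodule.mem_sup.1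
      (hcompl.sup_eq_top ▸ Submodule.mem_top : y ∈ Vp ⊔ Vm)
    have e : D (D x) - D (D (D (D a))) = D (D (D (D b))) := by
      rw [hy]; simp
    have m1 : D (D x) - D (D (D (D a))) ∈ Vp :=
      Vp.sub_mem (hodd₂ _ (hodd₁ _ hx)) (hodd₂ _ (hodd₁ _ (hodd₂ _ (hodd₁ _ ha))))
    have m2 : D (D x) - D (D (D (D a))) ∈ Vm := by
      rw [e]; exact hodd₁ _ (hodd₂ _ (hodd₁ _ (hodd₂ _ hb)))
    have z := Submodule.disjoint_def.1 hcompl.disjoint _ m1 m2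
    rw [sub_eq_zero.1 z]
    exact ⟨_, ⟨_, ⟨_, hodd₁ _ ha, rfl⟩, rfl⟩, rfl⟩
  exact (Submodule.finrank_mono h).trans (Submodule.finrank_map_le _ _)

lemma aux_range {k V : Type*} [Field k] [AddCommGroup V] [Module k V]
    (Vp Vm : Submodule k V) (hcompl : IsCompl Vp Vm)
    (D : V →ₗ[k] V)
    (hodd₁ : ∀ x ∈ Vp, D x ∈ Vm) (hodd₂ : ∀ x ∈ Vm, D x ∈ Vp) :
    LinearMap.range D ⊓ Vm = Vp.map D := by
  apply le_antisymm
  · rintro _ ⟨⟨y, rfl⟩, hy⟩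
    obtain ⟨a, ha, b, hb, rfl⟩ := Submodule.mem_sup.1
      (hcompl.sup_eq_top ▸ Submodule.mem_top : y ∈ Vp ⊔ Vm)
    have m : D b ∈ Vm := by
      have := Vm.sub_mem hy (hodd₁ a ha)
      simpa using this
    have z := Submodule.disjoint_def.1 hcompl.disjoint _ (hodd₂ b hb) m
    exact ⟨a, ha, by simp [z]⟩
  · rintro _ ⟨a, ha, rfl⟩
    exact ⟨⟨a, rfl⟩, hodd₁ a ha⟩


/-- Euler–Poincaré principle for an odd operator with diagonalizable square:
if `V = V⁺ ⊕ V⁻` and `D` is odd with `D²` diagonalizable, then `ker D` and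
`range D` are graded, and
`dim V⁺ − dim V⁻ = (dim H⁺ − dim H'⁺) − (dim H⁻ − dim H'⁻)` where
`H = ker D` and `H' = ker D ∩ range D`. -/
theorem dirac_index_euler_poincare
    {k V : Type*} [Field k] [AddCommGroup V] [Module k V] [FiniteDimensional k V]
    (Vp Vm : Submodule k V) (hcompl : IsCompl Vp Vm)
    (D : V →ₗ[k] V)
    (hodd₁ : ∀ x ∈ Vp, D x ∈ Vm) (hodd₂ : ∀ x ∈ Vm, D x ∈ Vp)
    (hdiag : (⨆ μ : k, Module.End.eigenspace (D ∘ₗ D) μ) = ⊤) :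
    (LinearMap.ker D = LinearMap.ker D ⊓ Vp ⊔ LinearMap.ker D ⊓ Vm) ∧
    (LinearMap.range D = LinearMap.range D ⊓ Vp ⊔ LinearMap.range D ⊓ Vm) ∧
    ((Module.finrank k Vp : ℤ) - (Module.finrank k Vm : ℤ) =
      ((Module.finrank k ↥(LinearMap.ker D ⊓ Vp) : ℤ) -
        (Module.finrank k ↥(LinearMap.ker D ⊓ LinearMap.range D ⊓ Vp) : ℤ)) -
      ((Module.finrank k ↥(LinearMap.ker D ⊓ Vm) : ℤ) -
        (Module.finrank k ↥(LinearMap.ker D ⊓ LinearMap.range D ⊓ Vm) : ℤ))) := by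
  have r1 := aux_range Vp Vm hcompl D hodd₁ hodd₂
  have r2 := aux_range Vm Vp hcompl.symm D hodd₂ hodd₁
  refine ⟨?_, ?_, ?_⟩
  · apply le_antisymm
    · intro y hy
      obtain ⟨a, ha, b, hb, rfl⟩ := Submodule.mem_sup.1
        (hcompl.sup_eq_top ▸ Submodule.mem_top : y ∈ Vp ⊔ Vm)
      have e : D a = - D b := by
        rw [LinearMap.mem_ker, map_add] at hy
        exact eq_neg_of_add_eq_zero_left hy
      have z : D a = 0 := Submodule.disjoint_def.1 hcompl.disjoint _
        (e ▸ Vp.neg_mem (hodd₂ b hb)) (hodd₁ a ha)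
      have z' : D b = 0 := by simpa [z] using e
      exact Submodule.add_mem_sup ⟨z, ha⟩ ⟨z', hb⟩
    · exact sup_le inf_le_left inf_le_left
  · rw [r1, r2, ← Submodule.map_sup, hcompl.symm.sup_eq_top, LinearMap.range_eq_map]
  · rw [inf_assoc, inf_assoc, r1, r2]
    have a1 := aux_rank D Vp
    have a2 := aux_rank D Vm
    have a3 := aux_rank D (Vp.map D)
    have a4 := aux_rank D (Vm.map D)
    have l1 := aux_le Vp Vm hcompl D hodd₁ hodd₂ hdiag
    have l2 := aux_le Vm Vp hcompl.symm D hodd₂ hodd₁ hdiag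
    omega
end

section
/- For every integer n ≥ 2, D_{n,n−1} = (−1)^n · V(λ_2,…,λ_n) = (−1)^n · ∏_{2 ≤ p < q ≤ n} (λ_p − λ_q) in ℤ[λ_1,…,λ_n]. -/
open MvPolynomial Finset

/-- The `n × n` matrix `M_{n,i}` (1-indexed in the paper, 0-indexed here):
rows `0,…,n−3` contain the powers `λⱼ^{n−2−k}`, row `n−2` contains the
indicator of `j ≤ n−i`, row `n−1` the indicator of `j > n−i`. -/
noncomputable def kingMatrix (n i : ℕ) : Matrix (Fin n) (Fin n) (MvPolynomial (Fin n) ℤ) :=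
  fun k j =>
    if (k : ℕ) < n - 2 then MvPolynomial.X j ^ (n - 2 - (k : ℕ))
    else if (k : ℕ) = n - 2 then (if (j : ℕ) < n - i then 1 else 0)
    else (if (j : ℕ) < n - i then 0 else 1)

/-- The Goldie rank (character) polynomial `D_{n,i} = det M_{n,i}` of the
discrete series `X_λ(i)` of `SU(n,1)`, up to a nonzero constant. -/
noncomputable def kingPoly (n i : ℕ) : MvPolynomial (Fin n) ℤ := (kingMatrix n i).det

/-- For `i = n−1`, the Goldie rank polynomial of the (antiholomorphic) discrete
series of `SU(n,1)` is `(−1)^n · V(λ_2,…,λ_n)`. -/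
theorem kingPoly_last (n : ℕ) (hn : 2 ≤ n) :
    kingPoly n (n - 1) =
      (-1) ^ n *
        ∏ pq ∈ Finset.univ.filter
            (fun pq : Fin n × Fin n => 0 < (pq.1 : ℕ) ∧ pq.1 < pq.2),
          (MvPolynomial.X pq.1 - MvPolynomial.X pq.2) := by
  obtain ⟨m, rfl⟩ : ∃ m, n = m + 2 := ⟨n - 2, by omega⟩
  have hlt : m < m + 2 := by omega
  have key : ((kingMatrix (m + 2) (m + 2 - 1)).submatrix
      (Fin.succAbove (⟨m, hlt⟩ : Fin (m + 2))) (Fin.succAbove 0)) =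
      (Matrix.projVandermonde (fun _ : Fin (m + 1) => (1 : MvPolynomial (Fin (m + 2)) ℤ))
        (fun j => MvPolynomial.X j.succ)).transpose := by
    ext1 k j
    have hk := k.isLt
    have h1 : m + 2 - (m + 2 - 1) = 1 := by omega
    simp only [Matrix.submatrix_apply, Matrix.transpose_apply, Matrix.projVandermonde_apply,
      kingMatrix, Fin.succAbove_zero, h1, one_pow, one_mul, Fin.val_rev, Fin.val_succ]
    by_cases h : (k : ℕ) < m
    · rw [Fin.succAbove_of_castSucc_lt _ _ (by simpa [Fin.lt_def] using h)]
      simp only [Fin.val_castSucc]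
      rw [if_pos (by omega)]
      congr 1
      omega
    · have hkm : (k : ℕ) = m := by omega
      rw [Fin.succAbove_of_le_castSucc _ _ (by simp [Fin.le_def, hkm])]
      simp [hkm]
  have hrow : ∀ j : Fin (m + 2), kingMatrix (m + 2) (m + 2 - 1) ⟨m, hlt⟩ j =
      if j = 0 then 1 else 0 := by
    intro j
    have h1 : m + 2 - (m + 2 - 1) = 1 := by omega
    have h2 : ((j : ℕ) < 1) ↔ j = 0 := by
      rw [Fin.ext_iff, Fin.val_zero]; omega
    unfold kingMatrix
    rw [h1, if_neg (by simp), if_pos (by simp)]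
    simp only [h2]
  rw [kingPoly, Matrix.det_succ_row _ (⟨m, hlt⟩ : Fin (m + 2)),
    Finset.sum_eq_single (0 : Fin (m + 2))]
  · rw [key, Matrix.det_transpose, Matrix.det_projVandermonde, hrow]
    rw [if_pos rfl, mul_one, Fin.val_zero, add_zero]
    simp only [one_mul, mul_one]
    have hs : (-1 : MvPolynomial (Fin (m + 2)) ℤ) ^ (m + 2) = (-1) ^ m := by
      rw [pow_add]; simp
    rw [hs]
    congr 1
    rw [Finset.prod_sigma']
    refine Finset.prod_bij (fun x _ => (x.1.succ, x.2.succ)) ?_ ?_ ?_ ?_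
    · intro x hx
      simpa using hx
    · rintro ⟨a, b⟩ _ ⟨c, d⟩ _ h
      simpa using h
    · rintro ⟨a, b⟩ h
      simp only [Finset.mem_filter, Finset.mem_univ, true_and] at h
      obtain ⟨h0, h1⟩ := h
      obtain ⟨a', rfl⟩ := Fin.exists_succ_eq.mpr (show a ≠ 0 by
        rintro rfl; simp at h0)
      obtain ⟨b', rfl⟩ := Fin.exists_succ_eq.mpr (show b ≠ 0 by
        rintro rfl; simp at h1)
      exact ⟨⟨a', b'⟩, by simpa using h1, rfl⟩
    · intro x _
      rfl
  · intro j _ hj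
    rw [hrow, if_neg hj]
    simp
  · simp
end

section
/- In ℤ[λ_1,…,λ_5] one has the identity D_{5,2} = −(λ_1−λ_2)(λ_1−λ_3)(λ_2−λ_3)(λ_4−λ_5)·q, where q = λ_1λ_2+λ_1λ_3−λ_1λ_4−λ_1λ_5+λ_2λ_3−λ_2λ_4−λ_2λ_5−λ_3λ_4−λ_3λ_5+λ_4²+λ_4λ_5+λ_5². -/
open MvPolynomial Finset

theorem king_det_aux {R : Type*} [CommRing R] (a b c d e : R) :
    Matrix.det !![a ^ 3, b ^ 3, c ^ 3, d ^ 3, e ^ 3; a ^ 2, b ^ 2, c ^ 2, d ^ 2, e ^ 2;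
      a, b, c, d, e; 1, 1, 1, 0, 0; 0, 0, 0, 1, 1] =
      -((a - b) * (a - c) * (b - c) * (d - e) *
          (a * b + a * c - a * d - a * e + b * c - b * d - b * e - c * d - c * e
            + d ^ 2 + d * e + e ^ 2)) := by
  simp [Matrix.det_succ_row_zero, Fin.sum_univ_succ, Fin.succAbove]
  ring

/-- `D_{5,2} = −(λ_1−λ_2)(λ_1−λ_3)(λ_2−λ_3)(λ_4−λ_5)·q` (variables 0-indexed). -/
theorem kingPoly_five_two :
    kingPoly 5 2 =
      -((X 0 - X 1) * (X 0 - X 2) * (X 1 - X 2) * (X 3 - X 4) *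
          (X 0 * X 1 + X 0 * X 2 - X 0 * X 3 - X 0 * X 4 + X 1 * X 2
            - X 1 * X 3 - X 1 * X 4 - X 2 * X 3 - X 2 * X 4
            + X 3 ^ 2 + X 3 * X 4 + X 4 ^ 2) :
          MvPolynomial (Fin 5) ℤ) := by
  rw [← king_det_aux, kingPoly]
  congr 1
  ext1 k j
  fin_cases k <;> fin_cases j <;> simp [kingMatrix]
end

section
/- The quadratic polynomial q = λ_1λ_2+λ_1λ_3−λ_1λ_4−λ_1λ_5+λ_2λ_3−λ_2λ_4−λ_2λ_5−λ_3λ_4−λ_3λ_5+λ_4²+λ_4λ_5+λ_5² is irreducible in the polynomial ring ℚ[λ_1,…,λ_5] (the multivariate polynomial ring MvPolynomial (Fin 5) ℚ). -/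
open MvPolynomial

lemma notMem_vars_of_supported {p : MvPolynomial (Fin 5) ℚ} {i : Fin 5}
    (h : p ∈ supported ℚ ({i}ᶜ : Set (Fin 5))) : i ∉ p.vars := by
  intro hi
  exact (mem_supported.1 h) hi rfl

lemma X_mem_supp {i j : Fin 5} (h : j ≠ i) :
    (X j : MvPolynomial (Fin 5) ℚ) ∈ supported ℚ ({i}ᶜ : Set (Fin 5)) :=
  X_mem_supported.2 h

lemma linear_irreducible :
    Irreducible (X 1 + X 2 - X 3 - X 4 : MvPolynomial (Fin 5) ℚ) := by
  have h := irreducible_mul_X_add (1 : MvPolynomial (Fin 5) ℚ) (X 2 - X 3 - X 4) 1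
    one_ne_zero (notMem_vars_of_supported (one_mem _))
    (notMem_vars_of_supported
      (sub_mem (sub_mem (X_mem_supp (by decide)) (X_mem_supp (by decide)))
        (X_mem_supp (by decide))))
    isRelPrime_one_left
  convert h using 1
  ring

/-- The quadratic factor `q` of the Goldie rank polynomial `D_{5,2}` of a
discrete series of `SU(5,1)` is irreducible in `ℚ[λ_1,…,λ_5]`
(variables 0-indexed). -/
theorem quadratic_factor_irreducible :
    Irreducible
      ((X 0 * X 1 + X 0 * X 2 - X 0 * X 3 - X 0 * X 4 + X 1 * X 2
          - X 1 * X 3 - X 1 * X 4 - X 2 * X 3 - X 2 * X 4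
          + X 3 ^ 2 + X 3 * X 4 + X 4 ^ 2) :
        MvPolynomial (Fin 5) ℚ) := by
  have h1 := X_mem_supp (i := 0) (j := 1) (by decide)
  have h2 := X_mem_supp (i := 0) (j := 2) (by decide)
  have h3 := X_mem_supp (i := 0) (j := 3) (by decide)
  have h4 := X_mem_supp (i := 0) (j := 4) (by decide)
  have h := irreducible_mul_X_add (X 1 + X 2 - X 3 - X 4 : MvPolynomial (Fin 5) ℚ)
    (X 1 * X 2 - (X 1 + X 2) * (X 3 + X 4) + (X 3 * X 3 + X 3 * X 4 + X 4 * X 4)) 0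
    linear_irreducible.ne_zero
    (notMem_vars_of_supported (sub_mem (sub_mem (add_mem h1 h2) h3) h4))
    (notMem_vars_of_supported
      (add_mem (sub_mem (mul_mem h1 h2) (mul_mem (add_mem h1 h2) (add_mem h3 h4)))
        (add_mem (add_mem (mul_mem h3 h3) (mul_mem h3 h4)) (mul_mem h4 h4))))
    (by
      rw [linear_irreducible.isRelPrime_iff_not_dvd]
      rintro ⟨c, hc⟩
      have := congrArg (eval (![0, 1, 1, 2, 0] : Fin 5 → ℚ)) hc
      simp at this
      norm_num at this)
  convert h using 1
  ring
end

section
/- Let n ≥ 4 and 2 ≤ i ≤ n−2 be integers, and let p, q be indices with 1 ≤ p ≤ n−i < q ≤ n. Then the polynomial obtained from D_{n,i} by the substitution λ_q ↦ λ_p is equal, up to sign (i.e. up to multiplication by ±1), to the image under the same substitution of the Vandermonde polynomial V(λ_1,…,λ_{p−1},λ_{p+1},…,λ_n) in the n−1 variables omitting λ_p. -/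
open MvPolynomial Finset

/-- Vandermonde with reversed exponents, squared. -/
lemma det_rev_vand_sq {R : Type*} [CommRing R] (m : ℕ) (v : Fin m → R) :
    (Matrix.det (fun k j : Fin m => v j ^ (m - 1 - (k : ℕ)))) ^ 2
      = ∏ ab ∈ Finset.univ.filter (fun ab : Fin m × Fin m => ab.1 < ab.2),
          (v ab.1 - v ab.2) ^ 2 := by
  have h1 : (fun k j : Fin m => v j ^ (m - 1 - (k : ℕ)) : Matrix (Fin m) (Fin m) R)
      = (Matrix.vandermonde v).transpose.submatrix Fin.revPerm id := by
    ext k j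
    simp only [Matrix.submatrix_apply, Matrix.transpose_apply, Matrix.vandermonde_apply, id,
      Fin.revPerm_apply, Fin.val_rev]
    congr 1
    omega
  rw [h1, Matrix.det_permute, Matrix.det_transpose, Matrix.det_vandermonde, mul_pow]
  have h2 : (((Equiv.Perm.sign (Fin.revPerm : Equiv.Perm (Fin m)) : ℤˣ) : ℤ) : R) ^ 2 = 1 := by
    rcases Int.units_eq_one_or (Equiv.Perm.sign (Fin.revPerm : Equiv.Perm (Fin m))) with h | h <;>
      simp [h]
  rw [h2, one_mul, Finset.prod_filter, Fintype.prod_prod_type, ← Finset.prod_pow]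
  refine Finset.prod_congr rfl fun a _ => ?_
  rw [← Finset.prod_filter, ← Finset.prod_pow]
  refine Finset.prod_congr (by ext; simp) fun b _ => by ring

lemma prod_succAbove {R : Type*} [CommRing R] (m : ℕ) (p : Fin (m + 1))
    (g : Fin (m + 1) → Fin (m + 1) → R) :
    ∏ ab ∈ Finset.univ.filter (fun ab : Fin m × Fin m => ab.1 < ab.2),
        g (p.succAbove ab.1) (p.succAbove ab.2)
      = ∏ ab ∈ Finset.univ.filter
          (fun ab : Fin (m + 1) × Fin (m + 1) => ab.1 < ab.2 ∧ ab.1 ≠ p ∧ ab.2 ≠ p),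
          g ab.1 ab.2 := by
  refine Finset.prod_bij (fun ab _ => (p.succAbove ab.1, p.succAbove ab.2)) ?_ ?_ ?_ ?_
  · rintro ⟨a, b⟩ h
    simpa [Fin.succAbove_lt_succAbove_iff, Fin.succAbove_ne] using h
  · rintro ⟨a, b⟩ _ ⟨c, d⟩ _ h
    simpa using h
  · rintro ⟨a, b⟩ h
    simp only [Finset.mem_filter, Finset.mem_univ, true_and] at h
    obtain ⟨h1, h2, h3⟩ := h
    obtain ⟨a, rfl⟩ := Fin.exists_succAbove_eq h2
    obtain ⟨b, rfl⟩ := Fin.exists_succAbove_eq h3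
    exact ⟨(a, b), by simpa using h1, rfl⟩
  · intros
    rfl

lemma king_det_sq {R : Type*} [CommRing R] (m s : ℕ) (x : Fin (m + 2) → R)
    (p q : Fin (m + 2)) (hp : (p : ℕ) < s) (hq : s ≤ (q : ℕ)) (hx : x q = x p)
    (N : Matrix (Fin (m + 2)) (Fin (m + 2)) R)
    (hN : ∀ k j, N k j = if (k : ℕ) < m then x j ^ (m - (k : ℕ))
      else if (k : ℕ) = m then (if (j : ℕ) < s then 1 else 0)
      else (if (j : ℕ) < s then 0 else 1)) :
    N.det ^ 2 = (Matrix.det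
      (fun k j : Fin (m + 1) => x (p.succAbove j) ^ (m + 1 - 1 - (k : ℕ)))) ^ 2 := by
  have hpq : p ≠ q := by rintro rfl; omega
  let r : Fin (m + 2) := ⟨m, by omega⟩
  have hlr : Fin.last (m + 1) ≠ r := by simp [r, Fin.ext_iff]
  rw [← Matrix.det_updateCol_add_smul_self N hpq (-1)]
  set N1 := N.updateCol p (fun k => N k p + (-1 : R) • N k q) with hN1
  rw [← Matrix.det_updateRow_add_smul_self N1 hlr 1]
  set N2 := N1.updateRow (Fin.last (m + 1)) (N1 (Fin.last (m + 1)) + (1 : R) • N1 r) with hN2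
  have hcol : ∀ k, N2 k p = if k = r then 1 else 0 := by
    intro k
    have e1 : ∀ k, N1 k p = N k p - N k q := by intro k; simp [hN1, sub_eq_add_neg]
    by_cases hk : k = Fin.last (m + 1)
    · subst hk
      simp [hN2, e1, hN, hlr, r, hp, hq, not_lt.mpr hq]
    · have hk' : (k : ℕ) ≠ m + 1 := fun h => hk (Fin.ext (by simpa using h))
      rw [hN2, Matrix.updateRow_ne hk, e1, hN, hN]
      have := k.2
      by_cases h : (k : ℕ) < m
      · have : k ≠ r := by rintro rfl; simp [r] at h
        simp [h, hx, this]
      · have : (k : ℕ) = m := by omega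
        have h2 : k = r := Fin.ext this
        simp [this, h2, r, hp, not_lt.mpr hq]
  rw [Matrix.det_succ_column N2 p, Finset.sum_eq_single r]
  · rw [hcol, if_pos rfl, mul_one, mul_pow, ← pow_mul, mul_comm _ 2, pow_mul]
    simp only [even_two, Even.neg_pow, one_pow, one_mul]
    congr 2
    ext k j
    have hj : p.succAbove j ≠ p := Fin.succAbove_ne p j
    rw [Matrix.submatrix_apply]
    by_cases hk : (k : ℕ) < m
    · have h1 : r.succAbove k = k.castSucc := by
        apply Fin.succAbove_of_castSucc_lt
        simpa [Fin.lt_def, r] using hk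
      have h2 : k.castSucc ≠ Fin.last (m + 1) := Fin.castSucc_ne_last k
      rw [h1, hN2, Matrix.updateRow_ne h2, hN1, Matrix.updateCol_ne hj, hN]
      simp [hk]
    · have hk' : k = Fin.last m := Fin.ext (by have := k.2; simp; omega)
      have h1 : r.succAbove k = Fin.last (m + 1) := by
        rw [Fin.succAbove_of_le_castSucc, hk', Fin.succ_last]
        simp [Fin.le_def, r]; omega
      rw [h1, hN2, Matrix.updateRow_self]
      simp only [Pi.add_apply, Pi.smul_apply, hN1, Matrix.updateCol_ne hj, hN, hk', r]
      by_cases hs : (p.succAbove j : ℕ) < s <;> simp [hs]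
  · intro k _ hk
    rw [hcol, if_neg hk]; simp
  · simp

/-- For `n ≥ 4`, `2 ≤ i ≤ n−2` and `p ≤ n−i < q` (1-indexed; here 0-indexed),
the substitution `λ_q ↦ λ_p` sends `D_{n,i}` to `±` the image of the
Vandermonde polynomial `V(λ_1,…,λ_{p−1},λ_{p+1},…,λ_n)` under the same
substitution. -/
theorem kingPoly_substitution (n i : ℕ) (hn : 4 ≤ n) (hi₁ : 2 ≤ i)
    (hi₂ : i ≤ n - 2) (p q : Fin n)
    (hp : (p : ℕ) < n - i) (hq : n - i ≤ (q : ℕ)) :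
    MvPolynomial.rename (fun j => if j = q then p else j) (kingPoly n i) =
        MvPolynomial.rename (fun j => if j = q then p else j)
          (∏ ab ∈ Finset.univ.filter
              (fun ab : Fin n × Fin n => ab.1 < ab.2 ∧ ab.1 ≠ p ∧ ab.2 ≠ p),
            (MvPolynomial.X ab.1 - MvPolynomial.X ab.2)) ∨
      MvPolynomial.rename (fun j => if j = q then p else j) (kingPoly n i) =
        -MvPolynomial.rename (fun j => if j = q then p else j)
          (∏ ab ∈ Finset.univ.filter
              (fun ab : Fin n × Fin n => ab.1 < ab.2 ∧ ab.1 ≠ p ∧ ab.2 ≠ p),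
            (MvPolynomial.X ab.1 - MvPolynomial.X ab.2)) := by
  obtain ⟨m, rfl⟩ : ∃ m, n = m + 2 := ⟨n - 2, by omega⟩
  rw [← sq_eq_sq_iff_eq_or_eq_neg]
  set f : Fin (m + 2) → Fin (m + 2) := fun j => if j = q then p else j with hf
  have hpq : p ≠ q := by rintro rfl; omega
  rw [kingPoly, AlgHom.map_det, king_det_sq m (m + 2 - i) (fun j => X (f j)) p q hp hq
    (by simp [hf]), det_rev_vand_sq,
    prod_succAbove (m + 1) p (fun a b => ((X (f a) : MvPolynomial (Fin (m + 2)) ℤ) - X (f b)) ^ 2),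
    map_prod, ← Finset.prod_pow]
  · simp only [map_sub, rename_X]
  · intro k j
    simp only [AlgHom.mapMatrix_apply, Matrix.map_apply, kingMatrix, Nat.add_sub_cancel]
    split_ifs <;> simp
end

section
/- For all integers n ≥ 2 and 1 ≤ i ≤ n−1, the polynomial D_{n,i} is a nonzero homogeneous polynomial of degree (n−1)(n−2)/2 in ℤ[λ_1,…,λ_n]. -/
open MvPolynomial Finset

theorem king_sum (m : ℕ) : ∑ k : Fin (m + 2), (m + 2 - 2 - (k : ℕ)) = (m + 2 - 1) * (m + 2 - 2) / 2 := by
  rw [Fin.sum_univ_eq_sum_range (fun k => m + 2 - 2 - k) (m + 2), Finset.sum_range_succ]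
  have h := Finset.sum_range_reflect (fun k => k) (m + 1)
  have h2 := Finset.sum_range_id (m + 1)
  simp only [Nat.add_sub_cancel] at *
  rw [show m + 2 - 1 = m + 1 by omega, ← h2, ← h]
  simp

theorem king_hom (m i : ℕ) :
    (kingPoly (m + 2) i).IsHomogeneous ((m + 2 - 1) * (m + 2 - 2) / 2) := by
  unfold kingPoly
  rw [Matrix.det_apply]
  apply MvPolynomial.IsHomogeneous.sum
  intro σ _
  have hp : (∏ j, kingMatrix (m + 2) i (σ j) j).IsHomogeneous ((m + 2 - 1) * (m + 2 - 2) / 2) := by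
    rw [← king_sum, ← Equiv.sum_comp σ]
    apply MvPolynomial.IsHomogeneous.prod
    intro j _
    unfold kingMatrix
    split_ifs with h1 h2 h3 h3
    · exact MvPolynomial.isHomogeneous_X_pow _ _
    all_goals
      rw [show m + 2 - 2 - ((σ j : Fin (m + 2)) : ℕ) = 0 by omega]
      first
        | exact MvPolynomial.isHomogeneous_one _ _
        | exact MvPolynomial.isHomogeneous_zero _ _ _
  rcases Int.units_eq_one_or (Equiv.Perm.sign σ) with h | h
  · rw [h, one_smul]; exact hp
  · rw [h, Units.neg_smul, one_smul]; exact hp.neg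

theorem king_ne (m i : ℕ) (hi₁ : 1 ≤ i) (hi₂ : i ≤ m + 1) : kingPoly (m + 2) i ≠ 0 := by
  intro h0
  let f : Fin (m + 2) → ℤ := fun j => if (j : ℕ) = m + 1 then 0 else (j : ℕ)
  have hdet : ((kingMatrix (m + 2) i).map (MvPolynomial.eval f)).det = 0 := by
    have := RingHom.map_det (MvPolynomial.eval f) (kingMatrix (m + 2) i)
    rw [← kingPoly, h0, map_zero] at this
    exact this.symm
  obtain ⟨v, hv, hvM⟩ := Matrix.exists_vecMul_eq_zero_iff.mpr hdet
  have key : ∀ j : Fin (m + 2), (∑ k : Fin m, v k.castSucc.castSucc * f j ^ (m - (k : ℕ)))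
      + v (Fin.last m).castSucc * (if (j : ℕ) < m + 2 - i then 1 else 0)
      + v (Fin.last (m + 1)) * (if (j : ℕ) < m + 2 - i then 0 else 1) = 0 := by
    intro j
    have := congrFun hvM j
    rw [Matrix.vecMul, dotProduct, Fin.sum_univ_castSucc, Fin.sum_univ_castSucc] at this
    simp only [Pi.zero_apply] at this
    refine Eq.trans ?_ this
    congr 1
    · congr 1
      · apply Finset.sum_congr rfl
        intro k _
        simp [kingMatrix]
      · simp [kingMatrix, apply_ite (MvPolynomial.eval f)]
    · simp [kingMatrix, apply_ite (MvPolynomial.eval f)]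
  have hz : ∑ k : Fin m, v k.castSucc.castSucc * (0 : ℤ) ^ (m - (k : ℕ)) = 0 := by
    apply Finset.sum_eq_zero
    intro k _
    rw [zero_pow (by omega), mul_zero]
  have ha : v (Fin.last m).castSucc = 0 := by
    have := key 0
    rw [show f 0 = 0 by simp [f], hz] at this
    simpa [show 0 < m + 2 - i by omega] using this
  have hb : v (Fin.last (m + 1)) = 0 := by
    have := key (Fin.last (m + 1))
    rw [show f (Fin.last (m + 1)) = 0 by simp [f], hz] at this
    simpa [show ¬ (m + 1 < m + 2 - i) by omega] using this
  simp only [ha, hb, zero_mul, add_zero] at key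
  let p : Polynomial ℤ :=
    ∑ k : Fin m, Polynomial.C (v k.castSucc.castSucc) * Polynomial.X ^ (m - (k : ℕ))
  have hdeg : p.natDegree ≤ m := by
    apply Polynomial.natDegree_sum_le_of_forall_le
    intro k _
    exact (Polynomial.natDegree_C_mul_X_pow_le _ _).trans (by omega)
  have hp : p = 0 := by
    apply Polynomial.eq_zero_of_natDegree_lt_card_of_eval_eq_zero p
      (f := fun j : Fin (m + 1) => ((j : ℕ) : ℤ))
    · intro a b hab
      apply Fin.ext
      simpa using hab
    · intro j
      have := key j.castSucc
      rw [show f j.castSucc = ((j : ℕ) : ℤ) by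
        have := j.2
        simp only [f, Fin.val_castSucc]
        rw [if_neg (by omega)]] at this
      simpa [p, Polynomial.eval_finsetSum] using this
    · simpa using Nat.lt_succ_of_le hdeg
  apply hv
  funext k
  refine Fin.lastCases hb (fun k => ?_) k
  refine Fin.lastCases ha (fun k => ?_) k
  have hc : p.coeff (m - (k : ℕ)) = v k.castSucc.castSucc := by
    simp only [p, Polynomial.finsetSum_coeff, Polynomial.coeff_C_mul_X_pow]
    rw [Finset.sum_eq_single k]
    · simp
    · intro b _ hbk
      rw [if_neg]
      intro h
      apply hbk
      apply Fin.ext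
      omega
    · simp
  rw [← hc, hp]
  simp

/-- For `n ≥ 2` and `1 ≤ i ≤ n−1`, the Goldie rank polynomial `D_{n,i}` is a
nonzero homogeneous polynomial of degree `(n−1)(n−2)/2`. -/
theorem kingPoly_homogeneous (n i : ℕ) (hn : 2 ≤ n) (hi₁ : 1 ≤ i)
    (hi₂ : i ≤ n - 1) :
    kingPoly n i ≠ 0 ∧
      (kingPoly n i).IsHomogeneous ((n - 1) * (n - 2) / 2) := by
  obtain ⟨m, rfl⟩ := Nat.exists_eq_add_of_le' hn
  exact ⟨king_ne m i hi₁ (by omega), king_hom m i⟩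
end

section
/- In ℚ[λ_1,λ_2,λ_3,λ_4], the linear polynomial λ_1+λ_2−λ_3−λ_4 does not divide the Vandermonde polynomial ∏_{1 ≤ p < q ≤ 4}(λ_p − λ_q). -/
open MvPolynomial Finset

/-- The linear factor `λ_1+λ_2−λ_3−λ_4` of the Goldie rank polynomial of the
discrete series `X_λ(2)` of `SU(4,1)` does not divide the Vandermonde
polynomial (the index polynomial) in `ℚ[λ_1,…,λ_4]` (variables 0-indexed). -/
theorem linear_factor_not_dvd_vandermonde :
    ¬ ((X 0 + X 1 - X 2 - X 3 : MvPolynomial (Fin 4) ℚ) ∣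
        ∏ pq ∈ Finset.univ.filter (fun pq : Fin 4 × Fin 4 => pq.1 < pq.2),
          (MvPolynomial.X pq.1 - MvPolynomial.X pq.2)) := by
  rintro ⟨c, hc⟩
  have h := congrArg (MvPolynomial.eval (![0, 3, 1, 2] : Fin 4 → ℚ)) hc
  have h0 : MvPolynomial.eval (![0, 3, 1, 2] : Fin 4 → ℚ)
      (X 0 + X 1 - X 2 - X 3 : MvPolynomial (Fin 4) ℚ) = 0 := by
    simp
    norm_num
  rw [map_mul, h0, zero_mul, map_prod, Finset.prod_eq_zero_iff] at h
  obtain ⟨⟨p, q⟩, hpq, h⟩ := h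
  simp only [Finset.mem_filter, Finset.mem_univ, true_and] at hpq
  simp only [map_sub, MvPolynomial.eval_X] at h
  fin_cases p <;> fin_cases q <;> first
    | exact absurd hpq (by decide)
    | (norm_num at h; done)
    | (simp at h; done)
end
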